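/- Let (R, m) be a noetherian F-pure local ring of prime characteristic p. Then for every ideal I of R and every integer n ≥ 1, the integral closure of I^{dim(R)+n} is contained in I^n. -/

import Mathlib

universe u

/-- The integral closure of an ideal `J`: the set of `r` satisfying an equation
`r ^ m + a 1 * r ^ (m-1) + ⋯ + a m = 0` with `a i ∈ J ^ i`. -/
def Ideal.intClosure {R : Type*} [CommRing R] (J : Ideal R) : Set R :=
  { r | ∃ m : ℕ, 0 < m ∧ ∃ a : ℕ → R, (∀ i, 1 ≤ i → i ≤ m → a i ∈ J ^ i) ∧
      r ^ m + ∑ i ∈ Finset.Icc 1 m, a i * r ^ (m - i) = 0 }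

/-- A copy of `R` regarded as a module over itself via the Frobenius endomorphism. -/
def FrobeniusTwist (R : Type u) (_p : ℕ) : Type u := R

instance {R : Type u} [CommRing R] {p : ℕ} : AddCommGroup (FrobeniusTwist R p) :=
  inferInstanceAs (AddCommGroup R)

noncomputable instance {R : Type u} [CommRing R] {p : ℕ} [Fact p.Prime] [CharP R p] :
    Module R (FrobeniusTwist R p) :=
  Module.compHom R (frobenius R p)

/-- The Frobenius `r ↦ r ^ p`, viewed as an `R`-linear map from `R` to the Frobenius twist
of `R`. -/
noncomputable def frobeniusLinearMap (R : Type u) [CommRing R] (p : ℕ) [Fact p.Prime]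
    [CharP R p] : R →ₗ[R] FrobeniusTwist R p :=
  Module.compHom.toLinearMap (frobenius R p)

/-- A ring `R` of prime characteristic `p` is *F-pure* if the Frobenius endomorphism
`φ : r ↦ r ^ p` is pure, i.e. `φ ⊗ id_M` is injective for every `R`-module `M`. -/
def IsFPure (R : Type u) [CommRing R] (p : ℕ) [Fact p.Prime] [CharP R p] : Prop :=
  ∀ (M : Type u) [AddCommGroup M] [Module R M],
    Function.Injective (LinearMap.rTensor M (frobeniusLinearMap R p))

section Frobenius

variable {R : Type u} [CommRing R] {p : ℕ} [Fact p.Prime] [CharP R p]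

/-- An element of `R`, regarded as an element of its Frobenius twist. -/
def FrobeniusTwist.of {R : Type u} (p : ℕ) (r : R) : FrobeniusTwist R p := r

/-- In an F-pure ring every ideal is contracted from its Frobenius power. -/
lemma IsFPure.mem_of_pow_mem_map_frobenius (hFP : IsFPure R p) {J : Ideal R} {r : R}
    (h : r ^ p ∈ J.map (frobenius R p)) : r ∈ J := by
  have key : ∀ y ∈ J.map (frobenius R p),
      FrobeniusTwist.of p y ⊗ₜ[R] (Ideal.Quotient.mk J 1) = 0 := by
    intro y hy
    refine Submodule.span_induction (p := fun y _ ↦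
      FrobeniusTwist.of p y ⊗ₜ[R] (Ideal.Quotient.mk J 1) = 0) ?_ ?_ ?_ ?_ hy
    · rintro _ ⟨j, hj, rfl⟩
      have h₁ : FrobeniusTwist.of p (frobenius R p j) =
          j • FrobeniusTwist.of p 1 := (mul_one (frobenius R p j)).symm
      rw [h₁, TensorProduct.smul_tmul]
      have : j • (Ideal.Quotient.mk J 1) = 0 := by
        rw [← Ideal.Quotient.mk_eq_mk, ← Submodule.Quotient.mk_smul, Submodule.Quotient.mk_eq_zero]
        simpa using hj
      rw [this, TensorProduct.tmul_zero]
    · exact TensorProduct.zero_tmul _ _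
    · intro a b _ _ ha hb
      have := TensorProduct.add_tmul (R := R) (FrobeniusTwist.of p a) (FrobeniusTwist.of p b)
        (Ideal.Quotient.mk J 1)
      rw [ha, hb, add_zero] at this
      exact this
    · intro c a _ ha
      let f : FrobeniusTwist R p →ₗ[R] FrobeniusTwist R p :=
        { toFun := fun z ↦ (c * (show R from z) : R)
          map_add' := fun z w ↦ mul_add c (show R from z) (show R from w)
          map_smul' := fun t z ↦ mul_left_comm c (frobenius R p t) (show R from z) }
      have := congrArg (f.rTensor (R ⧸ J)) ha
      rw [LinearMap.rTensor_tmul, map_zero] at this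
      exact this
  have h₀ : (r : R) ⊗ₜ[R] (Ideal.Quotient.mk J 1) = 0 := by
    apply hFP (R ⧸ J)
    rw [map_zero, LinearMap.rTensor_tmul]
    exact key _ h
  have h₁ := congrArg (TensorProduct.lid R (R ⧸ J)) h₀
  rw [TensorProduct.lid_tmul, map_zero, ← Ideal.Quotient.mk_eq_mk, ← Submodule.Quotient.mk_smul,
    Submodule.Quotient.mk_eq_zero] at h₁
  simpa using h₁

lemma IsFPure.mem_of_pow_mem_map_iterateFrobenius (hFP : IsFPure R p) {J : Ideal R} {r : R}
    (e : ℕ) (h : r ^ p ^ e ∈ J.map (iterateFrobenius R p e)) : r ∈ J := by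
  induction e with
  | zero => simpa using h
  | succ e ih =>
    apply ih
    apply hFP.mem_of_pow_mem_map_frobenius
    rw [Ideal.map_map, ← pow_mul, ← pow_succ]
    convert h using 2
    ext x
    simp [frobenius_def, iterateFrobenius_def, pow_succ, pow_mul]

end Frobenius

section Length

variable {R : Type*} [CommRing R]

lemma Module.length_quotient_sup_span_mul_le (J : Ideal R) (a b : R) :
    Module.length R (R ⧸ J ⊔ Ideal.span {a * b}) ≤
      Module.length R (R ⧸ J ⊔ Ideal.span {b}) + Module.length R (R ⧸ J ⊔ Ideal.span {a}) := by
  set A := J ⊔ Ideal.span {a * b}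
  let f : (R ⧸ J ⊔ Ideal.span {b}) →ₗ[R] R ⧸ A :=
    Submodule.mapQ _ _ (LinearMap.mulLeft R a) (by
      refine sup_le (fun j hj ↦ ?_) ?_
      · exact Ideal.mem_sup_left (J.mul_mem_left a hj)
      · rw [Ideal.span_le, Set.singleton_subset_iff]
        exact Ideal.mem_sup_right (Ideal.mem_span_singleton_self _))
  let g : (R ⧸ J ⊔ Ideal.span {a}) →ₗ[R] (R ⧸ A) ⧸ f.range :=
    Submodule.liftQ _ (f.range.mkQ ∘ₗ A.mkQ) (by
      refine sup_le (fun j hj ↦ ?_) ?_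
      · have : A.mkQ j = 0 := by
          rw [Submodule.mkQ_apply, Submodule.Quotient.mk_eq_zero]
          exact Ideal.mem_sup_left hj
        simp only [LinearMap.mem_ker, LinearMap.comp_apply, this, map_zero]
      · rw [Ideal.span_le, Set.singleton_subset_iff]
        simp only [SetLike.mem_coe, LinearMap.mem_ker, LinearMap.comp_apply]
        rw [Submodule.mkQ_apply, Submodule.Quotient.mk_eq_zero]
        refine ⟨Submodule.Quotient.mk 1, ?_⟩
        change Submodule.Quotient.mk (a * 1) = _
        rw [mul_one, Submodule.mkQ_apply])
  have hg : Function.Surjective g := by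
    intro y
    obtain ⟨y, rfl⟩ := Submodule.mkQ_surjective _ y
    obtain ⟨y, rfl⟩ := Submodule.mkQ_surjective _ y
    exact ⟨Submodule.Quotient.mk y, rfl⟩
  rw [Module.length_eq_add_of_exact f.range.subtype f.range.mkQ (Submodule.subtype_injective _)
    (Submodule.mkQ_surjective _) (LinearMap.exact_subtype_mkQ _)]
  exact add_le_add (Module.length_le_of_surjective _ f.surjective_rangeRestrict)
    (Module.length_le_of_surjective g hg)

lemma Module.length_quotient_sup_span_pow_le (J : Ideal R) (a : R) (k : ℕ) :
    Module.length R (R ⧸ J ⊔ Ideal.span {a ^ k}) ≤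
      k * Module.length R (R ⧸ J ⊔ Ideal.span {a}) := by
  induction k with
  | zero => simp
  | succ k ih =>
    rw [pow_succ]
    refine (Module.length_quotient_sup_span_mul_le J _ _).trans ?_
    rw [Nat.cast_succ, add_mul, one_mul, add_comm]
    gcongr

lemma Module.length_quotient_sup_span_image_pow_le [DecidableEq R] (s : Finset R) (k : ℕ)
    (J : Ideal R) :
    Module.length R (R ⧸ J ⊔ Ideal.span ((· ^ k) '' (s : Set R))) ≤
      (k : ℕ∞) ^ s.card * Module.length R (R ⧸ J ⊔ Ideal.span (s : Set R)) := by
  induction s using Finset.induction_on generalizing J with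
  | empty => rw [Finset.coe_empty, Set.image_empty, Finset.card_empty, pow_zero, one_mul]
  | insert a s ha ih =>
    rw [Finset.coe_insert, Set.image_insert_eq, Ideal.span_insert, Ideal.span_insert,
      Finset.card_insert_of_notMem ha, sup_comm (Ideal.span {a ^ k}), ← sup_assoc]
    refine (Module.length_quotient_sup_span_pow_le _ _ _).trans ?_
    rw [pow_succ', mul_assoc, sup_right_comm, ← sup_assoc]
    gcongr
    exact ih _

end Length

section Monomials

open IsLocalRing

variable {R : Type*} [CommRing R] {s : ℕ}

lemma Ideal.span_range_pow_eq_span_monomials (x : Fin s → R)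
    (N : ℕ) :
    Ideal.span (Set.range x) ^ N =
      Ideal.span {y | ∃ u : Fin s → ℕ, ∑ i, u i = N ∧ y = ∏ i, x i ^ u i} := by
  apply le_antisymm
  · intro y hy
    obtain ⟨f, hf, rfl⟩ := (Ideal.mem_span_pow_iff_exists_isHomogeneous x y).mp hy
    rw [MvPolynomial.eval_eq']
    refine Ideal.sum_mem _ fun v hv ↦ Ideal.mul_mem_left _ _ (Ideal.subset_span ⟨v, ?_, rfl⟩)
    have := hf (MvPolynomial.mem_support_iff.mp hv)
    rw [Finsupp.weight_apply, Finsupp.sum_fintype _ _ (by simp)] at this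
    simpa using this
  · rw [Ideal.span_le]
    rintro _ ⟨u, rfl, rfl⟩
    rw [← Finset.prod_pow_eq_pow_sum]
    exact Ideal.prod_mem_prod fun i _ ↦
      Ideal.pow_mem_pow (Ideal.subset_span (Set.mem_range_self i)) _

lemma prod_pow_mem_span_range_pow (x : Fin s → R) (u : Fin s → ℕ) :
    ∏ i, x i ^ u i ∈ Ideal.span (Set.range x) ^ ∑ i, u i := by
  rw [Ideal.span_range_pow_eq_span_monomials]
  exact Ideal.subset_span ⟨u, rfl, rfl⟩

variable [IsLocalRing R]

/-- The ideal generated by the monomials in `x` of the degree of `u` which are lexicographically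
smaller than `u`, together with `𝔪 I ^ |u|`, where `I` is generated by `x`. -/
def lowerIdeal (x : Fin s → R) (u : Fin s → ℕ) : Ideal R :=
  Ideal.span {y | ∃ v : Fin s → ℕ, ∑ i, v i = ∑ i, u i ∧ toLex v < toLex u ∧
    y = ∏ i, x i ^ v i} ⊔ maximalIdeal R * Ideal.span (Set.range x) ^ ∑ i, u i

/-- The exponents of the monomials which cannot be rewritten, modulo `𝔪 I ^ |u|`, in terms of
smaller ones. -/
def IsStandard (x : Fin s → R) (u : Fin s → ℕ) : Prop :=
  ∏ i, x i ^ u i ∉ lowerIdeal x u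

lemma lowerIdeal_le (x : Fin s → R) (u : Fin s → ℕ) :
    lowerIdeal x u ≤ Ideal.span (Set.range x) ^ ∑ i, u i := by
  refine sup_le ?_ Ideal.mul_le_right
  rw [Ideal.span_le]
  rintro _ ⟨v, hv, -, rfl⟩
  rw [← hv]
  exact prod_pow_mem_span_range_pow x v

lemma IsStandard.of_add {x : Fin s → R} {u w : Fin s → ℕ} (h : IsStandard x (u + w)) :
    IsStandard x u := by
  intro hu
  apply h
  have hdeg : ∀ v : Fin s → ℕ, ∑ i, (v + w) i = ∑ i, v i + ∑ i, w i := fun v ↦ by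
    simp [Finset.sum_add_distrib]
  have hmon : ∀ v : Fin s → ℕ,
      ∏ i, x i ^ (v + w) i = (∏ i, x i ^ w i) * ∏ i, x i ^ v i := fun v ↦ by
    simp [pow_add, Finset.prod_mul_distrib, mul_comm]
  have hle : lowerIdeal x u ≤
      Submodule.comap (LinearMap.mulLeft R (∏ i, x i ^ w i)) (lowerIdeal x (u + w)) := by
    refine sup_le (Ideal.span_le.mpr ?_) fun y hy ↦ ?_
    · rintro _ ⟨v, hv, hlt, rfl⟩
      refine Ideal.mem_sup_left (Ideal.subset_span ⟨v + w, ?_, ?_, ?_⟩)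
      · rw [hdeg, hdeg, hv]
      · exact add_lt_add_left hlt (toLex w)
      · exact (hmon v).symm
    · refine Ideal.mem_sup_right ?_
      rw [hdeg, pow_add, ← mul_assoc, mul_comm]
      exact Ideal.mul_mem_mul (prod_pow_mem_span_range_pow x w) hy
  rw [hmon]
  exact hle hu

lemma IsStandard.anti {x : Fin s → R} {u v : Fin s → ℕ} (h : IsStandard x v) (huv : u ≤ v) :
    IsStandard x u := by
  rw [← add_tsub_cancel_of_le huv] at h
  exact h.of_add

lemma span_range_pow_le_span_standard [IsNoetherianRing R] (x : Fin s → R) (N : ℕ) :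
    Ideal.span (Set.range x) ^ N ≤
      Ideal.span {y | ∃ u, IsStandard x u ∧ ∑ i, u i = N ∧ y = ∏ i, x i ^ u i} := by
  set W := Ideal.span {y | ∃ u, IsStandard x u ∧ ∑ i, u i = N ∧ y = ∏ i, x i ^ u i}
  have key : ∀ u : Lex (Fin s → ℕ), ∑ i, ofLex u i = N →
      ∏ i, x i ^ ofLex u i ∈ W ⊔ maximalIdeal R * Ideal.span (Set.range x) ^ N := by
    intro u
    induction u using WellFoundedLT.induction with
    | ind u ih =>
      intro hu
      by_cases hs : IsStandard x (ofLex u)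
      · exact Ideal.mem_sup_left (Ideal.subset_span ⟨_, hs, hu, rfl⟩)
      · have hle : lowerIdeal x (ofLex u) ≤
            W ⊔ maximalIdeal R * Ideal.span (Set.range x) ^ N := by
          refine sup_le (Ideal.span_le.mpr ?_) (hu ▸ le_sup_right)
          rintro _ ⟨v, hv, hlt, rfl⟩
          exact ih (toLex v) hlt (hv.trans hu)
        exact hle (not_not.mp hs)
  refine Submodule.le_of_le_smul_of_le_jacobson_bot (I := maximalIdeal R)
    (IsNoetherian.noetherian _) (maximalIdeal_le_jacobson _) ?_
  conv_lhs => rw [Ideal.span_range_pow_eq_span_monomials]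
  rw [Ideal.span_le]
  rintro _ ⟨u, hu, rfl⟩
  exact key (toLex u) hu

lemma card_le_length_of_isStandard {x : Fin s → R}
    (hx : Ideal.span (Set.range x) ≤ maximalIdeal R) (K : ℕ) (T : Finset (Fin s → ℕ))
    (hT : ∀ u ∈ T, IsStandard x u ∧ ∑ i, u i < K) :
    (T.card : ℕ∞) ≤ Module.length R (R ⧸ Ideal.span (Set.range x) ^ K) + 1 := by
  classical
  set I := Ideal.span (Set.range x)
  rw [Module.length_quotient]
  let key : (Fin s → ℕ) → ℕᵒᵈ ×ₗ Lex (Fin s → ℕ) := fun u ↦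
    toLex (OrderDual.toDual (∑ i, u i), toLex u)
  let E : (Fin s → ℕ) → Ideal R := fun u ↦ lowerIdeal x u ⊔ Ideal.span {∏ i, x i ^ u i}
  have hlt : ∀ u, IsStandard x u → lowerIdeal x u < E u := fun u hu ↦
    left_lt_sup.mpr fun h ↦ hu (h (Ideal.mem_span_singleton_self _))
  have hEle : ∀ u, E u ≤ I ^ ∑ i, u i := fun u ↦
    sup_le (lowerIdeal_le x u) ((Ideal.span_singleton_le_iff_mem _).mpr
      (prod_pow_mem_span_range_pow x u))
  have hmul : ∀ {a b : ℕ}, a < b → I ^ b ≤ maximalIdeal R * I ^ a := fun {a b} hab ↦ by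
    refine (Ideal.pow_le_pow_right (Nat.succ_le_of_lt hab)).trans ?_
    rw [pow_succ']
    exact Ideal.mul_mono_left hx
  have hElow : ∀ u v, key u < key v → E u ≤ lowerIdeal x v := by
    intro u v huv
    rw [Prod.Lex.lt_iff] at huv
    rcases huv with h | ⟨h, h'⟩
    · exact (hEle u).trans ((hmul (OrderDual.toDual_lt_toDual.mp h)).trans le_sup_right)
    · have hd : ∑ i, u i = ∑ i, v i := OrderDual.toDual.injective h
      refine sup_le (sup_le (Ideal.span_le.mpr ?_) ?_) ?_
      · rintro _ ⟨w, hw, hwu, rfl⟩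
        exact Ideal.mem_sup_left (Ideal.subset_span ⟨w, hw.trans hd, hwu.trans h', rfl⟩)
      · rw [hd]; exact le_sup_right
      · rw [Ideal.span_singleton_le_iff_mem]
        exact Ideal.mem_sup_left (Ideal.subset_span ⟨u, hd, h', rfl⟩)
  have hinj : Function.Injective key := fun u v h ↦ by
    have := congrArg (fun z ↦ ofLex (ofLex z).2) h
    exact this
  rcases T.eq_empty_or_nonempty with rfl | hne
  · simp
  obtain ⟨n, hn⟩ : ∃ n, T.card = n + 1 := Nat.exists_eq_succ_of_ne_zero hne.card_pos.ne'
  let φ := (T.image key).orderEmbOfFin ((Finset.card_image_of_injective T hinj).trans hn)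
  have hφ : ∀ i, ∃ u ∈ T, key u = φ i := fun i ↦
    Finset.mem_image.mp (Finset.orderEmbOfFin_mem _ _ i)
  choose ψ hψT hψ using hφ
  let c : LTSeries (Ideal R) := LTSeries.mk n (fun i ↦ E (ψ i)) fun i j hij ↦
    (hElow _ _ (by rw [hψ, hψ]; exact φ.strictMono hij)).trans_lt (hlt _ (hT _ (hψT j)).1)
  have := Order.length_le_coheight (x := I ^ K) (p := c)
    ((hmul (hT _ (hψT 0)).2).trans (le_sup_right.trans (hlt _ (hT _ (hψT 0)).1).le))
  rw [hn]
  push_cast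
  gcongr
  exact this

end Monomials

section Growth

open IsLocalRing

variable {R : Type*} [CommRing R] [IsNoetherianRing R] [IsLocalRing R] {s : ℕ}

/-- Lengths of quotients by powers of an `𝔪`-primary ideal grow at most like `K ^ dim R`. -/
lemma exists_length_quotient_pow_le {d : ℕ} (hd : ringKrullDim R = (d : WithBot (WithTop ℕ)))
    {I : Ideal R} {c : ℕ} (hc : maximalIdeal R ^ c ≤ I) :
    ∃ A : ℕ, ∀ K : ℕ, Module.length R (R ⧸ I ^ K) ≤ (A * K ^ d : ℕ) := by
  classical
  obtain ⟨y, hy, hcard⟩ :=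
    (maximalIdeal R).exists_finset_card_eq_height_of_isNoetherianRing
  replace hcard : y.card = d := by
    have h := IsLocalRing.maximalIdeal_height_eq_ringKrullDim (R := R)
    rw [hd, ← hcard] at h
    exact Nat.cast_injective (R := WithBot ℕ∞) h
  have hart := quotient_artinian_of_mem_minimalPrimes_of_isLocalRing _ hy
  have hfin : Module.length R (R ⧸ Ideal.span (y : Set R)) ≠ ⊤ := by
    rw [Module.length_eq_of_surjective (S := R) (R := R ⧸ Ideal.span (y : Set R))
      Ideal.Quotient.mk_surjective]
    exact Module.length_ne_top
  obtain ⟨l, hl⟩ := ENat.ne_top_iff_exists.mp hfin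
  refine ⟨c ^ d * l, fun K ↦ ?_⟩
  have hle : ⊥ ⊔ Ideal.span ((· ^ (c * K)) '' (y : Set R)) ≤ I ^ K := by
    rw [bot_sup_eq, Ideal.span_le]
    rintro _ ⟨z, hz, rfl⟩
    refine Ideal.pow_right_mono hc K ?_
    rw [← pow_mul]
    exact Ideal.pow_mem_pow (hy.1.2 (Ideal.subset_span hz)) _
  refine (Module.length_le_of_surjective (Submodule.factor hle)
    (Submodule.factor_surjective hle)).trans ?_
  refine (Module.length_quotient_sup_span_image_pow_le y (c * K) ⊥).trans ?_
  rw [bot_sup_eq, ← hl, hcard]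
  norm_cast
  rw [mul_pow, mul_right_comm]

lemma exists_not_isStandard {d : ℕ} (hd : ringKrullDim R = (d : WithBot (WithTop ℕ)))
    {x : Fin s → R} {c : ℕ} (hc : maximalIdeal R ^ c ≤ Ideal.span (Set.range x))
    (hx : Ideal.span (Set.range x) ≤ maximalIdeal R) (L : Finset (Fin s)) (hL : L.card = d + 1) :
    ∃ u : Fin s → ℕ, (∀ i ∉ L, u i = 0) ∧ ¬ IsStandard x u := by
  by_contra! h
  obtain ⟨A, hA⟩ := exists_length_quotient_pow_le hd hc
  obtain ⟨M, hM⟩ : ∃ M, M = A * (s + 1) ^ d + 2 := ⟨_, rfl⟩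
  let T : Finset (Fin s → ℕ) := Fintype.piFinset fun i ↦ if i ∈ L then Finset.range M else {0}
  have hT : ∀ u ∈ T, IsStandard x u ∧ ∑ i, u i < s * M + 1 := by
    intro u hu
    rw [Fintype.mem_piFinset] at hu
    refine ⟨h u fun i hi ↦ by simpa [hi] using hu i, Nat.lt_succ_of_le ?_⟩
    have : ∀ i ∈ Finset.univ, u i ≤ M := fun i _ ↦ by
      have := hu i
      split_ifs at this
      · exact (Finset.mem_range.mp this).le
      · simp [Finset.mem_singleton.mp this]
    simpa using Finset.sum_le_card_nsmul _ _ _ this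
  have hcard : T.card = M ^ (d + 1) := by
    rw [Fintype.card_piFinset, ← hL, ← Finset.prod_const,
      ← Finset.prod_subset (Finset.subset_univ L) fun i _ hi ↦ by simp [hi]]
    exact Finset.prod_congr rfl fun i hi ↦ by simp [hi]
  have hle := (card_le_length_of_isStandard hx _ T hT).trans (add_le_add_left (hA _) 1)
  rw [hcard] at hle
  norm_cast at hle
  have h₁ : (s * M + 1) ^ d ≤ (s + 1) ^ d * M ^ d := by
    rw [← mul_pow]
    exact Nat.pow_le_pow_left (by rw [add_mul]; omega) d
  have h₂ : 1 ≤ M ^ d := Nat.one_le_pow _ _ (by omega)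
  have h₃ : M ^ (d + 1) ≤ (A * (s + 1) ^ d + 1) * M ^ d := by
    calc M ^ (d + 1) ≤ A * (s * M + 1) ^ d + 1 := hle
      _ ≤ A * ((s + 1) ^ d * M ^ d) + M ^ d := by gcongr
      _ = _ := by ring
  rw [pow_succ'] at h₃
  have := Nat.le_of_mul_le_mul_right h₃ h₂
  omega

lemma exists_bound_isStandard {d : ℕ} (hd : ringKrullDim R = (d : WithBot (WithTop ℕ)))
    {x : Fin s → R} {c : ℕ} (hc : maximalIdeal R ^ c ≤ Ideal.span (Set.range x))
    (hx : Ideal.span (Set.range x) ≤ maximalIdeal R) :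
    ∃ B : ℕ, ∀ u : Fin s → ℕ, IsStandard x u → (Finset.univ.filter (B ≤ u ·)).card ≤ d := by
  choose v hv hv' using exists_not_isStandard hd hc hx
  refine ⟨∑ L : {L : Finset (Fin s) // L.card = d + 1}, ∑ i, v L.1 L.2 i, fun u hu ↦ ?_⟩
  by_contra! hlt
  obtain ⟨L, hLsub, hL⟩ := Finset.exists_subset_card_eq (Nat.succ_le_of_lt hlt)
  refine hv' L hL (hu.anti fun i ↦ ?_)
  by_cases hi : i ∈ L
  · refine le_trans ?_ (Finset.mem_filter.mp (hLsub hi)).2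
    exact (Finset.single_le_sum (f := v L hL) (fun _ _ ↦ Nat.zero_le _)
      (Finset.mem_univ i)).trans
      (Finset.single_le_sum (f := fun L : {L : Finset (Fin s) // L.card = d + 1} ↦
        ∑ i, v L.1 L.2 i) (fun _ _ ↦ Nat.zero_le _) (Finset.mem_univ ⟨L, hL⟩))
  · simp [hv L hL i hi]

end Growth

section FrobeniusPowers

open IsLocalRing

lemma le_sum_div_of_card_le {s d B q n N : ℕ} (hq : 0 < q) {u : Fin s → ℕ}
    (hu : (Finset.univ.filter (B ≤ u ·)).card ≤ d) (hN : ∑ i, u i = N)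
    (h : q * n + d * q + s * B < N + q) : n ≤ ∑ i, u i / q := by
  by_contra! hlt
  have h₁ : ∀ i ∈ Finset.univ,
      u i ≤ q * (u i / q) + (if B ≤ u i then q else 0) + B := fun i _ ↦ by
    have := Nat.div_add_mod (u i) q
    have := Nat.mod_lt (u i) hq
    split_ifs <;> omega
  have h₂ := Finset.sum_le_sum h₁
  simp only [Finset.sum_add_distrib, ← Finset.mul_sum, ← Finset.sum_filter, Finset.sum_const,
    Finset.card_univ, Fintype.card_fin, smul_eq_mul, hN] at h₂
  have h₃ := Nat.mul_le_mul_right q hu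
  have h₄ := Nat.mul_le_mul_left q (Nat.succ_le_of_lt hlt)
  rw [Nat.mul_succ] at h₄
  omega

lemma prod_pow_mem_map_iterateFrobenius {R : Type*} [CommRing R] (p : ℕ) [Fact p.Prime]
    [CharP R p] {s : ℕ} (x : Fin s → R) {u : Fin s → ℕ} {n e : ℕ}
    (h : n ≤ ∑ i, u i / p ^ e) :
    ∏ i, x i ^ u i ∈ (Ideal.span (Set.range x) ^ n).map (iterateFrobenius R p e) := by
  have : ∏ i, x i ^ u i =
      (∏ i, x i ^ (u i % p ^ e)) * iterateFrobenius R p e (∏ i, x i ^ (u i / p ^ e)) := by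
    rw [iterateFrobenius_def, ← Finset.prod_pow, ← Finset.prod_mul_distrib]
    refine Finset.prod_congr rfl fun i _ ↦ ?_
    rw [← pow_mul, ← pow_add, mul_comm, Nat.mod_add_div]
  rw [this]
  exact Ideal.mul_mem_left _ _ (Ideal.mem_map_of_mem _
    (Ideal.pow_le_pow_right h (prod_pow_mem_span_range_pow x _)))

lemma exists_pow_le_map_iterateFrobenius {R : Type*} [CommRing R] [IsNoetherianRing R]
    [IsLocalRing R] (p : ℕ) [Fact p.Prime] [CharP R p] {d : ℕ}
    (hd : ringKrullDim R = (d : WithBot (WithTop ℕ))) {I : Ideal R} {c : ℕ}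
    (hc : maximalIdeal R ^ c ≤ I) (hI : I ≤ maximalIdeal R) :
    ∃ b : ℕ, ∀ e n N : ℕ, p ^ e * n + d * p ^ e + b < N + p ^ e →
      I ^ N ≤ (I ^ n).map (iterateFrobenius R p e) := by
  obtain ⟨s, x, rfl⟩ := Submodule.fg_iff_exists_fin_generating_family.mp (IsNoetherian.noetherian I)
  obtain ⟨B, hB⟩ := exists_bound_isStandard hd hc hI
  refine ⟨s * B, fun e n N h ↦ (span_range_pow_le_span_standard x N).trans ?_⟩
  rw [Ideal.span_le]
  rintro _ ⟨u, hu, hN, rfl⟩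
  exact prod_pow_mem_map_iterateFrobenius p x (le_sum_div_of_card_le
    (pow_pos (Fact.out : p.Prime).pos e) (hB u hu) hN h)

end FrobeniusPowers

section IntegralClosure

variable {R : Type*} [CommRing R]

lemma Ideal.intClosure_mono {J J' : Ideal R} (h : J ≤ J') : J.intClosure ⊆ J'.intClosure := by
  rintro r ⟨m, hm, a, ha, hr⟩
  exact ⟨m, hm, a, fun i h₁ h₂ ↦ Ideal.pow_right_mono h i (ha i h₁ h₂), hr⟩

lemma Ideal.exists_pow_add_mem_of_mem_intClosure {J : Ideal R} {r : R} (h : r ∈ J.intClosure) :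
    ∃ m : ℕ, ∀ t, r ^ (m + t) ∈ J ^ t := by
  obtain ⟨m, -, a, ha, hr⟩ := h
  refine ⟨m, fun t ↦ ?_⟩
  induction t using Nat.strong_induction_on with
  | _ t ih =>
    rw [pow_add, eq_neg_of_add_eq_zero_left hr, neg_mul, Finset.sum_mul]
    refine neg_mem (Ideal.sum_mem _ fun i hi ↦ ?_)
    obtain ⟨h₁, h₂⟩ := Finset.mem_Icc.mp hi
    rw [mul_assoc, ← pow_add]
    rcases le_total i t with hit | hit
    · have e₁ : m - i + t = m + (t - i) := by omega
      have e₂ : J ^ t = J ^ i * J ^ (t - i) := by rw [← pow_add, Nat.add_sub_cancel' hit]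
      rw [e₁, e₂]
      exact Ideal.mul_mem_mul (ha i h₁ h₂) (ih _ (by omega))
    · exact Ideal.mul_mem_right _ _ (Ideal.pow_le_pow_right hit (ha i h₁ h₂))

lemma Ideal.sup_pow_le (I J : Ideal R) (n : ℕ) : (I ⊔ J) ^ n ≤ I ^ n ⊔ J := by
  induction n with
  | zero => simp
  | succ n ih =>
    rw [pow_succ, pow_succ]
    refine (Ideal.mul_mono_left ih).trans ?_
    rw [Ideal.mul_sup, Ideal.sup_mul]
    exact sup_le (sup_le le_sup_left (Ideal.mul_le_left.trans le_sup_right))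
      (Ideal.mul_le_right.trans le_sup_right)

/-- **Krull's intersection theorem** modulo an ideal. -/
lemma IsLocalRing.mem_of_forall_mem_sup_maximalIdeal_pow [IsNoetherianRing R] [IsLocalRing R]
    {J : Ideal R} {r : R} (h : ∀ k, r ∈ J ⊔ maximalIdeal R ^ k) : r ∈ J := by
  have hbot := (maximalIdeal R).iInf_pow_smul_eq_bot_of_isLocalRing (M := R ⧸ J)
    (maximalIdeal.isMaximal R).ne_top
  rw [← Submodule.Quotient.mk_eq_zero, ← Submodule.mem_bot R, ← hbot, Submodule.mem_iInf]
  intro k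
  obtain ⟨j, hj, y, hy, rfl⟩ := Submodule.mem_sup.mp (h k)
  rw [Submodule.Quotient.mk_add, (Submodule.Quotient.mk_eq_zero J).mpr hj, zero_add]
  have : (Submodule.Quotient.mk y : R ⧸ J) = y • Submodule.Quotient.mk 1 := by
    rw [← Submodule.Quotient.mk_smul, smul_eq_mul, mul_one]
  rw [this]
  exact Submodule.smul_mem_smul hy trivial

end IntegralClosure

open IsLocalRing in
lemma intClosure_pow_dim_le_of_isFPure_of_primary {R : Type u} [CommRing R] [IsNoetherianRing R]
    [IsLocalRing R] {p : ℕ} [Fact p.Prime] [CharP R p] (hFP : IsFPure R p) {d : ℕ}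
    (hd : ringKrullDim R = (d : WithBot (WithTop ℕ))) {I : Ideal R} {c : ℕ}
    (hc : maximalIdeal R ^ c ≤ I) (hI : I ≤ maximalIdeal R) (n : ℕ) :
    (I ^ (d + n)).intClosure ⊆ ↑(I ^ n) := by
  intro r hr
  obtain ⟨m, hm⟩ := Ideal.exists_pow_add_mem_of_mem_intClosure hr
  obtain ⟨b, hb⟩ := exists_pow_le_map_iterateFrobenius p hd hc hI
  obtain ⟨e, he⟩ : ∃ e, (d + n) * m + b + m < p ^ e :=
    ⟨_, Nat.lt_pow_self (Fact.out : p.Prime).one_lt⟩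
  obtain ⟨t, ht⟩ : ∃ t, p ^ e = m + t := Nat.exists_eq_add_of_le (by omega)
  refine hFP.mem_of_pow_mem_map_iterateFrobenius e (hb e n ((d + n) * t) ?_ ?_)
  · rw [ht] at he ⊢
    nlinarith
  · rw [ht, pow_mul]
    exact hm t

/-- Let `(R, m)` be a noetherian F-pure local ring of prime characteristic `p`.  Then for every
ideal `I` and every `n ≥ 1`, the integral closure of `I ^ (dim R + n)` is contained in
`I ^ n`. -/
theorem intClosure_pow_dim_le_of_isFPure {R : Type u} [CommRing R]
    [IsNoetherianRing R] [IsLocalRing R]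
    (p : ℕ) [Fact p.Prime] [CharP R p] (hFP : IsFPure R p)
    (d : ℕ) (hd : ringKrullDim R = (d : WithBot (WithTop ℕ))) :
    ∀ I : Ideal R, ∀ n : ℕ, 1 ≤ n → (I ^ (d + n)).intClosure ⊆ ↑(I ^ n) := by
  intro I n _
  rcases eq_or_ne I ⊤ with rfl | hI
  · simp [Ideal.top_pow]
  intro r hr
  refine IsLocalRing.mem_of_forall_mem_sup_maximalIdeal_pow fun k ↦ ?_
  have hk : IsLocalRing.maximalIdeal R ^ (k + 1) ≤ IsLocalRing.maximalIdeal R :=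
    Ideal.pow_le_self k.succ_ne_zero
  have hmem := intClosure_pow_dim_le_of_isFPure_of_primary hFP hd
    (le_sup_right (a := I)) (sup_le (IsLocalRing.le_maximalIdeal hI) hk) n
    (Ideal.intClosure_mono (Ideal.pow_right_mono le_sup_left _) hr)
  have hle : I ^ n ⊔ IsLocalRing.maximalIdeal R ^ (k + 1) ≤ I ^ n ⊔ IsLocalRing.maximalIdeal R ^ k :=
    sup_le_sup_left (Ideal.pow_le_pow_right k.le_succ) _
  exact hle (Ideal.sup_pow_le _ _ _ hmem)
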